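/- Assume the standard setup, and suppose in addition that G has exactly k ≥ 1 pendant vertices and χ_la(G) = k + 1 = t, so that V_r is the unique color class containing no pendant vertex. Let i ∈ {1,…,k+1} with i ≠ r, and assume e + s·nᵢ ≥ c_r, where s ≥ 1 if nᵢ = 1 and s ≥ 2 is even if nᵢ ≥ 2. Then G(Vᵢ,s) has s·nᵢ + k − 1 pendant vertices and χ_la(G(Vᵢ,s)) = s·nᵢ + k. -/

import Mathlib

open Finset
open scoped Classical

namespace LocalAntimagic

variable {V : Type*}

/-- The induced vertex label: sum of the labels of edges incident to `v`. -/
noncomputable def vertexSum [Fintype V] (G : SimpleGraph V) (f : Sym2 V → ℕ) (v : V) : ℕ :=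
  ∑ e ∈ G.incidenceFinset v, f e

/-- `f` is a local antimagic labeling of `G`: a bijection from the edge set onto
`{1, …, |E|}` whose induced vertex labels distinguish adjacent vertices. -/
def IsLocalAntimagic [Fintype V] (G : SimpleGraph V) (f : Sym2 V → ℕ) : Prop :=
  Set.BijOn f G.edgeSet (Set.Icc 1 G.edgeFinset.card) ∧
  ∀ ⦃u v : V⦄, G.Adj u v → vertexSum G f u ≠ vertexSum G f v

/-- The color number `c(f)`: the number of distinct induced vertex labels. -/
noncomputable def colorCount [Fintype V] (G : SimpleGraph V) (f : Sym2 V → ℕ) : ℕ :=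
  (Finset.univ.image (vertexSum G f)).card

/-- The local antimagic chromatic number. -/
noncomputable def chiLA [Fintype V] (G : SimpleGraph V) : ℕ :=
  sInf {n | ∃ f, IsLocalAntimagic G f ∧ colorCount G f = n}

/-- A pendant vertex is a vertex of degree 1. -/
def IsPendant [Fintype V] (G : SimpleGraph V) (v : V) : Prop :=
  G.degree v = 1

/-- The number of pendant vertices of `G`. -/
noncomputable def pendantCount [Fintype V] (G : SimpleGraph V) : ℕ :=
  (Finset.univ.filter (fun v => IsPendant G v)).card

/-- `G(S, s)`: the graph obtained from `G` by attaching `s` new pendant edges to every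
vertex of `S`.  The new pendant vertex attached to `w ∈ S` via the `j`-th new edge is
`Sum.inr (w, j)`; the original graph lives on the `Sum.inl` vertices. -/
def attachPendants (G : SimpleGraph V) (S : Finset V) (s : ℕ) :
    SimpleGraph (V ⊕ (S × Fin s)) :=
  SimpleGraph.fromRel (fun a b =>
    (∃ u v : V, a = Sum.inl u ∧ b = Sum.inl v ∧ G.Adj u v) ∨
    (∃ (w : S) (j : Fin s), a = Sum.inl (w : V) ∧ b = Sum.inr (w, j)))

/-- The standard setup: `G` is a connected graph with at least `2` edges and
`χ_la(G) = t ≥ 2`; `f` is a local antimagic labeling of `G` with `c(f) = t` whose color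
classes are `Vset 1, …, Vset t` (each nonempty, with `f⁺ ≡ c i` on `Vset i`, and the
colors `c 1, …, c t` pairwise distinct); every non-pendant vertex lies in
`Vset 1 ∪ ⋯ ∪ Vset r` where `1 ≤ r ≤ t`; each `Vset i` with `r + 1 ≤ i ≤ t` is a
singleton consisting of a pendant vertex; `c 1 < c 2 < ⋯ < c r` and
`c (r+1) < c (r+2) < ⋯ < c t`. -/
structure StandardSetup [Fintype V] (G : SimpleGraph V) (f : Sym2 V → ℕ)
    (t r : ℕ) (Vset : ℕ → Finset V) (c : ℕ → ℕ) : Prop where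
  connected : G.Connected
  two_le_card_edges : 2 ≤ G.edgeFinset.card
  chiLA_eq : chiLA G = t
  two_le_t : 2 ≤ t
  antimagic : IsLocalAntimagic G f
  colorCount_eq : colorCount G f = t
  color_on_class : ∀ i ∈ Finset.Icc 1 t, ∀ v ∈ Vset i, vertexSum G f v = c i
  class_cover : ∀ v : V, ∃ i ∈ Finset.Icc 1 t, v ∈ Vset i
  class_nonempty : ∀ i ∈ Finset.Icc 1 t, (Vset i).Nonempty
  color_injective : ∀ i ∈ Finset.Icc 1 t, ∀ j ∈ Finset.Icc 1 t, i ≠ j → c i ≠ c j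
  one_le_r : 1 ≤ r
  r_le_t : r ≤ t
  nonpendant_mem : ∀ v : V, ¬ IsPendant G v → ∃ i ∈ Finset.Icc 1 r, v ∈ Vset i
  pendant_singleton : ∀ i ∈ Finset.Icc (r + 1) t, ∃ v : V, IsPendant G v ∧ Vset i = {v}
  c_strictMono_low : ∀ i j : ℕ, 1 ≤ i → i < j → j ≤ r → c i < c j
  c_strictMono_high : ∀ i j : ℕ, r + 1 ≤ i → i < j → j ≤ t → c i < c j

/-- `b`: the number of pendant vertices of `G` lying in `Vset 1 ∪ ⋯ ∪ Vset r`. -/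
noncomputable def pendantsInLow [Fintype V] (G : SimpleGraph V)
    (Vset : ℕ → Finset V) (r : ℕ) : ℕ :=
  (((Finset.Icc 1 r).biUnion Vset).filter (fun v => IsPendant G v)).card

lemma vertexSum_eq_sum_ite [Fintype V] (G : SimpleGraph V) (f : Sym2 V → ℕ) (v : V) :
    vertexSum G f v = ∑ w, if G.Adj v w then f s(v, w) else 0 := by
  have h : G.incidenceFinset v = (univ.filter (G.Adj v)).image (fun w => s(v, w)) := by
    ext x
    induction x using Sym2.ind with
    | _ a b =>
      simp only [SimpleGraph.mem_incidenceFinset, SimpleGraph.mk'_mem_incidenceSet_iff, mem_image,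
        mem_filter, mem_univ, true_and]
      constructor
      · rintro ⟨hab, rfl | rfl⟩
        · exact ⟨b, hab, rfl⟩
        · exact ⟨a, hab.symm, Sym2.eq_swap⟩
      · rintro ⟨w, hw, hs⟩
        rcases Sym2.eq_iff.1 hs with ⟨rfl, rfl⟩ | ⟨rfl, rfl⟩
        · exact ⟨hw, Or.inl rfl⟩
        · exact ⟨hw.symm, Or.inr rfl⟩
  rw [vertexSum, h, sum_image, sum_filter]
  intro a _ b _ hab
  exact Sym2.congr_right.1 hab

lemma label_le_vertexSum [Fintype V] {G : SimpleGraph V} (f : Sym2 V → ℕ) {u v : V}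
    (h : G.Adj u v) : f s(u, v) ≤ vertexSum G f u := by
  rw [vertexSum_eq_sum_ite]
  have := single_le_sum (f := fun w => if G.Adj u w then f s(u, w) else 0)
    (fun _ _ => Nat.zero_le _) (mem_univ v)
  simpa [h] using this

lemma exists_vertexSum_eq_of_isPendant [Fintype V] {G : SimpleGraph V} {v : V}
    (hv : IsPendant G v) (f : Sym2 V → ℕ) :
    ∃ w, G.Adj v w ∧ vertexSum G f v = f s(v, w) := by
  obtain ⟨w, hw⟩ := card_eq_one.1 hv
  have hadj : ∀ x, G.Adj v x ↔ x = w := fun x => by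
    rw [← SimpleGraph.mem_neighborFinset, hw, mem_singleton]
  refine ⟨w, (hadj w).2 rfl, ?_⟩
  simp [vertexSum_eq_sum_ite, hadj]

lemma label_lt_vertexSum_of_not_isPendant [Fintype V] {G : SimpleGraph V} {f : Sym2 V → ℕ}
    (hf : ∀ x ∈ G.edgeSet, 1 ≤ f x) {u v : V} (h : G.Adj u v) (hu : ¬ IsPendant G u) :
    f s(u, v) < vertexSum G f u := by
  have hdeg : 1 < (G.neighborFinset u).card := by
    have h0 : 0 < G.degree u := (G.degree_pos_iff_exists_adj u).2 ⟨v, h⟩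
    have h1 : G.degree u ≠ 1 := hu
    rw [SimpleGraph.card_neighborFinset_eq_degree]
    omega
  obtain ⟨w, hw, hwv⟩ := exists_mem_ne hdeg v
  rw [SimpleGraph.mem_neighborFinset] at hw
  rw [vertexSum_eq_sum_ite]
  have h2 := single_lt_sum (f := fun w => if G.Adj u w then f s(u, w) else 0)
    hwv (mem_univ v) (mem_univ w) (by simpa [hw] using Nat.lt_of_succ_le (hf _ hw)) (fun _ _ _ => Nat.zero_le _)
  simpa [h] using h2

namespace IsLocalAntimagic

variable [Fintype V] {G : SimpleGraph V} {f : Sym2 V → ℕ}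

lemma one_le (hf : IsLocalAntimagic G f) {x : Sym2 V} (hx : x ∈ G.edgeSet) : 1 ≤ f x :=
  (hf.1.mapsTo hx).1

lemma vertexSum_mem_Icc (hf : IsLocalAntimagic G f) {v : V} (hv : IsPendant G v) :
    vertexSum G f v ∈ Set.Icc 1 G.edgeFinset.card := by
  obtain ⟨w, hw, hs⟩ := exists_vertexSum_eq_of_isPendant hv f
  rw [hs]
  exact hf.1.mapsTo hw

lemma eq_of_isPendant (hf : IsLocalAntimagic G f) {u v : V} (hu : IsPendant G u)
    (hv : IsPendant G v) (h : vertexSum G f u = vertexSum G f v) : u = v := by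
  obtain ⟨a, ha, hua⟩ := exists_vertexSum_eq_of_isPendant hu f
  obtain ⟨b, hb, hvb⟩ := exists_vertexSum_eq_of_isPendant hv f
  have hs : s(u, a) = s(v, b) := hf.1.injOn ha hb (by rw [← hua, ← hvb, h])
  rcases Sym2.eq_iff.1 hs with ⟨huv, -⟩ | ⟨-, hav⟩
  · exact huv
  · exact absurd h (hf.2 (hav ▸ ha))

lemma exists_card_lt_vertexSum (hf : IsLocalAntimagic G f) (hE : 1 ≤ G.edgeFinset.card) :
    ∃ w, G.edgeFinset.card < vertexSum G f w := by
  obtain ⟨x, hx, hfx⟩ := hf.1.surjOn (Set.mem_Icc.2 ⟨hE, le_rfl⟩)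
  induction x using Sym2.ind with
  | _ a b =>
    rw [SimpleGraph.mem_edgeSet] at hx
    by_cases ha : IsPendant G a
    · by_cases hb : IsPendant G b
      · refine absurd ?_ (hf.2 hx)
        have ha' := (hf.vertexSum_mem_Icc ha).2
        have hb' := (hf.vertexSum_mem_Icc hb).2
        have ha'' := label_le_vertexSum f hx
        have hb'' := label_le_vertexSum f hx.symm
        rw [Sym2.eq_swap] at hb''
        omega
      · refine ⟨b, ?_⟩
        have := label_lt_vertexSum_of_not_isPendant (fun _ => hf.one_le) hx.symm hb
        rw [Sym2.eq_swap] at this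
        omega
    · refine ⟨a, ?_⟩
      have := label_lt_vertexSum_of_not_isPendant (fun _ => hf.one_le) hx ha
      omega

lemma pendantCount_lt_colorCount (hf : IsLocalAntimagic G f) (hE : 1 ≤ G.edgeFinset.card) :
    pendantCount G < colorCount G f := by
  obtain ⟨w, hw⟩ := hf.exists_card_lt_vertexSum hE
  have hinj : Set.InjOn (vertexSum G f) (univ.filter (fun v => IsPendant G v) : Finset V) := by
    intro u hu v hv h
    simp only [coe_filter, mem_univ, true_and, Set.mem_ofPred_eq] at hu hv
    exact hf.eq_of_isPendant hu hv h
  rw [pendantCount, colorCount, ← card_image_of_injOn hinj]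
  refine card_lt_card ((ssubset_iff_of_subset (image_subset_image (filter_subset _ _))).2
    ⟨vertexSum G f w, mem_image_of_mem _ (mem_univ w), ?_⟩)
  simp only [mem_image, mem_filter, mem_univ, true_and, not_exists, not_and]
  intro v hv h
  have := (hf.vertexSum_mem_Icc hv).2
  omega

end IsLocalAntimagic

section attachPendants

variable (G : SimpleGraph V) (S : Finset V) (s : ℕ)

@[simp]
lemma attachPendants_adj_inl_inl (u v : V) :
    (attachPendants G S s).Adj (Sum.inl u) (Sum.inl v) ↔ G.Adj u v := by
  simp only [attachPendants, SimpleGraph.fromRel_adj, Sum.inl.injEq, reduceCtorEq, and_false,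
    exists_false, or_false, ne_eq]
  constructor
  · rintro ⟨-, ⟨a, b, rfl, rfl, h⟩ | ⟨a, b, rfl, rfl, h⟩⟩
    exacts [h, h.symm]
  · exact fun h => ⟨h.ne, Or.inl ⟨u, v, rfl, rfl, h⟩⟩

@[simp]
lemma attachPendants_adj_inl_inr (u : V) (p : S × Fin s) :
    (attachPendants G S s).Adj (Sum.inl u) (Sum.inr p) ↔ u = p.1 := by
  obtain ⟨w, j⟩ := p
  simp only [attachPendants, SimpleGraph.fromRel_adj, Sum.inl.injEq, Sum.inr.injEq, reduceCtorEq,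
    false_and, and_false, exists_false, or_false, false_or, ne_eq, not_false_eq_true, true_and]
  constructor
  · rintro ⟨w', j', rfl, h⟩
    rw [(Prod.mk.inj h).1]
  · exact fun h => ⟨w, j, h, rfl⟩

@[simp]
lemma attachPendants_adj_inr_inl (p : S × Fin s) (u : V) :
    (attachPendants G S s).Adj (Sum.inr p) (Sum.inl u) ↔ u = p.1 := by
  rw [SimpleGraph.adj_comm, attachPendants_adj_inl_inr]

@[simp]
lemma attachPendants_adj_inr_inr (p q : S × Fin s) :
    ¬ (attachPendants G S s).Adj (Sum.inr p) (Sum.inr q) := by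
  simp [attachPendants]

variable [Fintype V]

lemma vertexSum_attachPendants_inl_of_mem (g : Sym2 (V ⊕ (S × Fin s)) → ℕ) (v : S) :
    vertexSum (attachPendants G S s) g (Sum.inl (v : V)) =
      vertexSum G (fun x => g (x.map Sum.inl)) v
        + ∑ j, g s(Sum.inl (v : V), Sum.inr (v, j)) := by
  simp only [vertexSum_eq_sum_ite, Fintype.sum_sum_type, attachPendants_adj_inl_inl,
    attachPendants_adj_inl_inr, Sym2.map_mk, Fintype.sum_prod_type]
  congr 1
  rw [Fintype.sum_eq_single v]
  · simp
  · intro w hw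
    exact sum_eq_zero fun j _ => if_neg fun h => hw (Subtype.ext h.symm)

lemma vertexSum_attachPendants_inl_of_notMem (g : Sym2 (V ⊕ (S × Fin s)) → ℕ) {v : V}
    (hv : v ∉ S) :
    vertexSum (attachPendants G S s) g (Sum.inl v) =
      vertexSum G (fun x => g (x.map Sum.inl)) v := by
  simp only [vertexSum_eq_sum_ite, Fintype.sum_sum_type, attachPendants_adj_inl_inl,
    attachPendants_adj_inl_inr, Sym2.map_mk]
  rw [add_eq_left]
  exact sum_eq_zero fun p _ => if_neg fun (h : v = (p.1 : V)) => hv (h ▸ p.1.2)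

lemma vertexSum_attachPendants_inr (g : Sym2 (V ⊕ (S × Fin s)) → ℕ) (p : S × Fin s) :
    vertexSum (attachPendants G S s) g (Sum.inr p) = g s(Sum.inl (p.1 : V), Sum.inr p) := by
  simp only [vertexSum_eq_sum_ite, Fintype.sum_sum_type, attachPendants_adj_inr_inl,
    attachPendants_adj_inr_inr, if_false, sum_const_zero, add_zero, sum_ite_eq', mem_univ, if_true]
  rw [Sym2.eq_swap]

lemma degree_eq_vertexSum_one (v : V) : G.degree v = vertexSum G (fun _ => 1) v := by
  rw [vertexSum, sum_const, smul_eq_mul, mul_one, SimpleGraph.card_incidenceFinset_eq_degree]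

lemma isPendant_iff_vertexSum_one (v : V) : IsPendant G v ↔ vertexSum G (fun _ => 1) v = 1 := by
  rw [IsPendant, degree_eq_vertexSum_one]

lemma pendantCount_attachPendants (hs : 1 ≤ s) (hS : ∀ v ∈ S, ∃ w, G.Adj v w) :
    pendantCount (attachPendants G S s) =
      (univ.filter (fun v => IsPendant G v ∧ v ∉ S)).card + s * S.card := by
  have hl : ∀ v : V, IsPendant (attachPendants G S s) (Sum.inl v) ↔ IsPendant G v ∧ v ∉ S := by
    intro v
    by_cases hv : v ∈ S
    · obtain ⟨w, hw⟩ := hS v hv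
      have h1 := label_le_vertexSum (fun _ => 1) hw
      have h2 := vertexSum_attachPendants_inl_of_mem G S s (fun _ => 1) ⟨v, hv⟩
      simp only [sum_const, card_univ, Fintype.card_fin, smul_eq_mul, mul_one] at h2
      simp only [isPendant_iff_vertexSum_one, h2, hv, not_true_eq_false, and_false, iff_false]
      omega
    · simp [isPendant_iff_vertexSum_one, vertexSum_attachPendants_inl_of_notMem, hv]
  have hr : ∀ p, IsPendant (attachPendants G S s) (Sum.inr p) := fun p => by
    rw [isPendant_iff_vertexSum_one, vertexSum_attachPendants_inr]
  simp only [pendantCount, card_filter, Fintype.sum_sum_type, hl, hr, if_true]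
  simp [mul_comm]

end attachPendants

/-- The edge labeling of `attachPendants G S s` given by `f` on `G` and by `L` on the new
edges. -/
def extendLabeling {S : Finset V} {s : ℕ} (f : Sym2 V → ℕ) (L : S × Fin s → ℕ) :
    Sym2 (V ⊕ (S × Fin s)) → ℕ :=
  Sym2.lift ⟨fun a b => a.elim (fun u => b.elim (fun v => f s(u, v)) L)
    (fun p => b.elim (fun _ => L p) (fun _ => 0)), by
      rintro (u | p) (v | q) <;> simp [Sym2.eq_swap]⟩

lemma extendLabeling_map_inl {S : Finset V} {s : ℕ} (f : Sym2 V → ℕ) (L : S × Fin s → ℕ)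
    (x : Sym2 V) : extendLabeling f L (x.map Sum.inl) = f x := by
  induction x using Sym2.ind with
  | _ a b => rfl

lemma bijOn_extendLabeling {G : SimpleGraph V} {S : Finset V} {s e m : ℕ} {f : Sym2 V → ℕ}
    {L : S × Fin s → ℕ} (hf : Set.BijOn f G.edgeSet (Set.Icc 1 e))
    (hL : Set.BijOn L Set.univ (Set.Icc (e + 1) (e + m))) :
    Set.BijOn (extendLabeling f L) (attachPendants G S s).edgeSet (Set.Icc 1 (e + m)) := by
  have hmem : ∀ x, x ∈ (attachPendants G S s).edgeSet ↔
      (∃ y ∈ G.edgeSet, y.map Sum.inl = x) ∨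
        ∃ p : S × Fin s, s(Sum.inl (p.1 : V), Sum.inr p) = x := by
    intro x
    constructor
    · induction x using Sym2.ind with
      | _ a b =>
        rw [SimpleGraph.mem_edgeSet]
        rcases a with u | p <;> rcases b with v | q <;> intro h
        · exact Or.inl ⟨s(u, v), by simpa using h, rfl⟩
        · rw [attachPendants_adj_inl_inr] at h
          exact Or.inr ⟨q, by rw [h]⟩
        · rw [attachPendants_adj_inr_inl] at h
          exact Or.inr ⟨p, by rw [h, Sym2.eq_swap]⟩
        · exact absurd h (attachPendants_adj_inr_inr G S s p q)
    · rintro (⟨y, hy, rfl⟩ | ⟨p, rfl⟩)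
      · induction y using Sym2.ind with
        | _ a b => simpa using hy
      · simp
  have hold : ∀ y ∈ G.edgeSet, 1 ≤ f y ∧ f y ≤ e := fun y hy => hf.mapsTo hy
  have hnew : ∀ p, e + 1 ≤ L p ∧ L p ≤ e + m := fun p => hL.mapsTo (Set.mem_univ p)
  have hg : ∀ p : S × Fin s, extendLabeling f L s(Sum.inl (p.1 : V), Sum.inr p) = L p :=
    fun _ => rfl
  refine ⟨fun x hx => ?_, fun x hx y hy hxy => ?_, fun l hl => ?_⟩
  · rcases (hmem x).1 hx with ⟨y, hy, rfl⟩ | ⟨p, rfl⟩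
    · rw [extendLabeling_map_inl]
      have := hold y hy
      exact ⟨by omega, by omega⟩
    · rw [hg]
      have := hnew p
      exact ⟨by omega, by omega⟩
  · rcases (hmem x).1 hx with ⟨x, hx', rfl⟩ | ⟨p, rfl⟩ <;>
      rcases (hmem y).1 hy with ⟨y, hy', rfl⟩ | ⟨q, rfl⟩ <;>
      simp only [extendLabeling_map_inl, hg] at hxy
    · rw [hf.injOn hx' hy' hxy]
    · have := hold x hx'
      have := hnew q
      omega
    · have := hold y hy'
      have := hnew p
      omega
    · rw [hL.injOn (Set.mem_univ p) (Set.mem_univ q) hxy]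
  · rcases Set.mem_Icc.1 hl with ⟨h1, h2⟩
    by_cases hle : l ≤ e
    · obtain ⟨y, hy, rfl⟩ := hf.surjOn (Set.mem_Icc.2 ⟨h1, hle⟩)
      exact ⟨_, (hmem _).2 (Or.inl ⟨y, hy, rfl⟩), extendLabeling_map_inl ..⟩
    · obtain ⟨p, -, rfl⟩ := hL.surjOn (Set.mem_Icc.2 ⟨by omega, h2⟩)
      exact ⟨_, (hmem _).2 (Or.inr ⟨p, rfl⟩), hg p⟩

lemma sum_boustrophedon_eq (n e a b m : ℕ) (ha : a < n) (hb : b < n) :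
    ∑ j ∈ range (m + m), (e + 1 + (j * n + if Even j then a else n - 1 - a)) =
      ∑ j ∈ range (m + m), (e + 1 + (j * n + if Even j then b else n - 1 - b)) := by
  induction m with
  | zero => rfl
  | succ m ih =>
    have h1 : Even (m + m) := ⟨m, rfl⟩
    have h2 : ¬ Even (m + m + 1) := by simp
    rw [show m + 1 + (m + 1) = m + m + 1 + 1 by ring]
    simp only [sum_range_succ, h1, h2, if_true, if_false] at ih ⊢
    omega

/-- Consecutive integers can be arranged in an array with constant row sums if the number of
columns is even or there is at most one row. -/
lemma exists_balanced_labeling {α : Type*} [Fintype α] (s e : ℕ)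
    (h : Fintype.card α ≤ 1 ∨ Even s) :
    ∃ L : α × Fin s → ℕ,
      Set.BijOn L Set.univ (Set.Icc (e + 1) (e + s * Fintype.card α)) ∧
      ∀ a b, ∑ j, L (a, j) = ∑ j, L (b, j) := by
  set n := Fintype.card α with hn
  let φ : α ≃ Fin n := Fintype.equivFin α
  let d : α × Fin s → ℕ := fun p => if Even (p.2 : ℕ) then (φ p.1 : ℕ) else n - 1 - φ p.1
  have hd : ∀ p, d p < n := fun p => by
    have := (φ p.1).2
    simp only [d]
    split_ifs <;> omega
  let L : α × Fin s → ℕ := fun p => e + 1 + (p.2 * n + d p)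
  have hinj : Function.Injective L := by
    rintro ⟨a, i⟩ ⟨b, j⟩ hab
    have hd1 := hd (a, i)
    have hd2 := hd (b, j)
    have hab' : (i : ℕ) * n + d (a, i) = j * n + d (b, j) := by
      simpa only [L, add_right_inj] using hab
    have hij : (i : ℕ) = j := by
      have hn0 : 0 < n := by omega
      have h3 := congrArg (· / n) hab'
      simpa only [mul_comm _ n, Nat.mul_add_div hn0, Nat.div_eq_of_lt hd1,
        Nat.div_eq_of_lt hd2, add_zero] using h3
    obtain rfl := Fin.ext hij
    have hdd : d (a, i) = d (b, i) := by omega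
    have ha := (φ a).2
    have hb := (φ b).2
    have hφ : (φ a : ℕ) = φ b := by
      simp only [d] at hdd
      split_ifs at hdd <;> omega
    rw [φ.injective (Fin.ext hφ)]
  have hmaps : ∀ p, L p ∈ Finset.Icc (e + 1) (e + s * n) := by
    rintro ⟨a, i⟩
    have h1 := hd (a, i)
    have h2 : ((i : ℕ) + 1) * n ≤ s * n := Nat.mul_le_mul_right n i.2
    rw [add_mul, one_mul] at h2
    rw [Finset.mem_Icc]
    simp only [L]
    omega
  refine ⟨L, ?_, fun a b => ?_⟩
  · have himg : univ.image L = Finset.Icc (e + 1) (e + s * n) := by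
      refine eq_of_subset_of_card_le (fun x hx => ?_) ?_
      · obtain ⟨p, -, rfl⟩ := mem_image.1 hx
        exact hmaps p
      · rw [card_image_of_injective _ hinj]
        simp [← hn, mul_comm]
    refine ⟨fun p _ => by simpa using hmaps p, hinj.injOn, fun x hx => ?_⟩
    have hx' : x ∈ univ.image L := himg ▸ Finset.mem_Icc.2 hx
    obtain ⟨p, -, rfl⟩ := mem_image.1 hx'
    exact ⟨p, trivial, rfl⟩
  · rcases h with h | ⟨m, rfl⟩
    · rw [Fintype.card_le_one_iff.1 h a b]
    · have := sum_boustrophedon_eq n e (φ a) (φ b) m (φ a).2 (φ b).2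
      rw [← Fin.sum_univ_eq_sum_range
          (fun j => e + 1 + (j * n + if Even j then (φ a : ℕ) else n - 1 - φ a)),
        ← Fin.sum_univ_eq_sum_range
          (fun j => e + 1 + (j * n + if Even j then (φ b : ℕ) else n - 1 - φ b))] at this
      exact this

/-- Corollary 2.5, case `i ≠ r`: in the standard setup, if `G` has
exactly `k ≥ 1` pendant vertices and `χ_la(G) = k + 1 = t`, so that `V_r` is the unique
color class containing no pendant vertex, then for `i ∈ {1, …, k + 1}` with `i ≠ r` and
`e + s·nᵢ ≥ c_r`, where `s ≥ 1` if `nᵢ = 1` and `s ≥ 2` is even if `nᵢ ≥ 2`,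
`G(Vᵢ, s)` has `s·nᵢ + k - 1` pendant vertices and `χ_la(G(Vᵢ, s)) = s·nᵢ + k`. -/
theorem chiLA_attachPendants_pendant_class_of_pendant_graph [Fintype V]
    (G : SimpleGraph V) (f : Sym2 V → ℕ) (t r : ℕ) (Vset : ℕ → Finset V) (c : ℕ → ℕ)
    (setup : StandardSetup G f t r Vset c)
    (k : ℕ) (hk : 1 ≤ k) (hpend : pendantCount G = k) (ht : t = k + 1)
    (hVr : ∀ v ∈ Vset r, ¬ IsPendant G v)
    (hVr' : ∀ i' ∈ Finset.Icc 1 t, i' ≠ r → ∃ v ∈ Vset i', IsPendant G v)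
    (e s i : ℕ) (he : G.edgeFinset.card = e)
    (hi₁ : 1 ≤ i) (hi₂ : i ≤ k + 1) (hir : i ≠ r)
    (hbig : c r ≤ e + s * (Vset i).card)
    (hs₁ : (Vset i).card = 1 → 1 ≤ s)
    (hs₂ : 2 ≤ (Vset i).card → 2 ≤ s ∧ Even s) :
    pendantCount (attachPendants G (Vset i) s) = s * (Vset i).card + k - 1 ∧
    chiLA (attachPendants G (Vset i) s) = s * (Vset i).card + k := by
  subst he ht
  set S := Vset i with hS
  have hf := setup.antimagic
  have hi : i ∈ Finset.Icc 1 (k + 1) := Finset.mem_Icc.2 ⟨hi₁, hi₂⟩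
  have hn : 1 ≤ S.card := card_pos.2 (setup.class_nonempty i hi)
  have hs : 1 ≤ s := by
    rcases hn.eq_or_lt with h | h
    · exact hs₁ h.symm
    · exact le_trans (by norm_num) (hs₂ h).1
  have hpos : 1 ≤ s * S.card := Nat.mul_pos hs hn
  have hlow : ∀ l ∈ Finset.Icc 1 (k + 1), l ≠ r → c l ∈ Set.Icc 1 G.edgeFinset.card := by
    intro l hl hlr
    obtain ⟨v, hv, hvp⟩ := hVr' l hl hlr
    rw [← setup.color_on_class l hl v hv]
    exact hf.vertexSum_mem_Icc hvp
  have hcr : G.edgeFinset.card < c r := by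
    obtain ⟨w, hw⟩ := hf.exists_card_lt_vertexSum (le_trans (by norm_num) setup.two_le_card_edges)
    obtain ⟨l, hl, hwl⟩ := setup.class_cover w
    rw [setup.color_on_class l hl w hwl] at hw
    by_cases hlr : l = r
    · rwa [← hlr]
    · exact absurd (hlow l hl hlr).2 (not_le.2 hw)
  have hadj : ∀ v ∈ S, ∃ w, G.Adj v w := by
    intro v hv
    by_contra! hno
    have h0 := setup.color_on_class i hi v hv
    have h1 := (hlow i hi hir).1
    simp only [vertexSum_eq_sum_ite, hno, if_false, sum_const_zero] at h0
    omega
  have hcount : pendantCount (attachPendants G S s) = s * S.card + k - 1 := by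
    have hone : (univ.filter (fun v => IsPendant G v ∧ v ∈ S)).card = 1 := by
      obtain ⟨v, hv, hvp⟩ := hVr' i hi hir
      refine card_eq_one.2 ⟨v, ?_⟩
      ext w
      simp only [mem_filter, mem_univ, true_and, mem_singleton]
      constructor
      · rintro ⟨hwp, hw⟩
        refine hf.eq_of_isPendant hwp hvp ?_
        rw [setup.color_on_class i hi w hw, setup.color_on_class i hi v hv]
      · rintro rfl
        exact ⟨hvp, hv⟩
    have hsplit := card_filter_add_card_filter_not
      (s := univ.filter (fun v => IsPendant G v)) (fun v => v ∈ S)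
    rw [filter_filter, filter_filter, hone] at hsplit
    rw [pendantCount] at hpend
    rw [pendantCount_attachPendants G S s hs hadj]
    omega
  refine ⟨hcount, ?_⟩
  obtain ⟨L, hL, hLsum⟩ := exists_balanced_labeling (α := S) s G.edgeFinset.card (by
    rw [Fintype.card_coe]
    rcases hn.eq_or_lt with h | h
    · exact Or.inl h.ge
    · exact Or.inr (hs₂ h).2)
  rw [Fintype.card_coe] at hL
  set g := extendLabeling f L
  have hbij := bijOn_extendLabeling hf.1 hL
  have hcard : (attachPendants G S s).edgeFinset.card = G.edgeFinset.card + s * S.card := by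
    have h1 := hbij.injOn.ncard_image
    rw [hbij.image_eq, ← SimpleGraph.coe_edgeFinset, Set.ncard_coe_finset, ← Finset.coe_Icc,
      Set.ncard_coe_finset, Nat.card_Icc] at h1
    omega
  have hgf : (fun x : Sym2 V => g (x.map Sum.inl)) = f := funext (extendLabeling_map_inl f L)
  obtain ⟨⟨w₀, j₀⟩, -, hp₀⟩ := hL.surjOn
    (Set.mem_Icc.2 ⟨by omega, le_rfl⟩ : G.edgeFinset.card + s * S.card ∈ _)
  set C := c i + ∑ j, L (w₀, j) with hC
  have hbigC : G.edgeFinset.card + s * S.card < C := by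
    have h1 := single_le_sum (f := fun j => L (w₀, j)) (fun _ _ => Nat.zero_le _) (mem_univ j₀)
    have h2 := (hlow i hi hir).1
    simp only [hp₀] at h1
    omega
  have hvS : ∀ v ∈ S, vertexSum (attachPendants G S s) g (Sum.inl v) = C := by
    intro v hv
    have h1 := vertexSum_attachPendants_inl_of_mem G S s g ⟨v, hv⟩
    rw [hgf, setup.color_on_class i hi v hv] at h1
    rw [h1, hC, hLsum w₀ ⟨v, hv⟩]
    rfl
  have hvN : ∀ v, v ∉ S →
      vertexSum (attachPendants G S s) g (Sum.inl v) = vertexSum G f v := by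
    intro v hv
    rw [vertexSum_attachPendants_inl_of_notMem G S s g hv, hgf]
  have hvR : ∀ p, vertexSum (attachPendants G S s) g (Sum.inr p) = L p :=
    fun p => vertexSum_attachPendants_inr G S s g p
  have hLle : ∀ p, L p ≤ G.edgeFinset.card + s * S.card := fun p => (hL.mapsTo trivial).2
  have hlt : ∀ v, vertexSum G f v < C := by
    intro v
    obtain ⟨l, hl, hvl⟩ := setup.class_cover v
    rw [setup.color_on_class l hl v hvl]
    by_cases hlr : l = r
    · subst hlr
      omega
    · have := (hlow l hl hlr).2
      omega
  have hg : IsLocalAntimagic (attachPendants G S s) g := by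
    refine ⟨hcard ▸ hbij, ?_⟩
    rintro (u | p) (v | q) huv
    · rw [attachPendants_adj_inl_inl] at huv
      by_cases hu : u ∈ S <;> by_cases hv : v ∈ S
      · refine absurd ?_ (hf.2 huv)
        rw [setup.color_on_class i hi u hu, setup.color_on_class i hi v hv]
      · rw [hvS u hu, hvN v hv]
        exact (hlt v).ne'
      · rw [hvN u hu, hvS v hv]
        exact (hlt u).ne
      · rw [hvN u hu, hvN v hv]
        exact hf.2 huv
    · rw [attachPendants_adj_inl_inr] at huv
      rw [huv, hvS _ q.1.2, hvR]
      exact ((hLle q).trans_lt hbigC).ne'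
    · rw [attachPendants_adj_inr_inl] at huv
      rw [huv, hvS _ p.1.2, hvR]
      exact ((hLle p).trans_lt hbigC).ne
    · exact absurd huv (attachPendants_adj_inr_inr G S s p q)
  have hup : colorCount (attachPendants G S s) g ≤ s * S.card + k := by
    set A := (((Finset.Icc 1 (k + 1)).erase i).erase r).image c
    set B := Finset.Icc (G.edgeFinset.card + 1) (G.edgeFinset.card + s * S.card) with hB
    have hsub : univ.image (vertexSum (attachPendants G S s) g) ⊆ (A ∪ B) ∪ {C} := by
      intro x hx
      obtain ⟨v | p, -, rfl⟩ := mem_image.1 hx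
      · by_cases hv : v ∈ S
        · simp [hvS v hv]
        · obtain ⟨l, hl, hvl⟩ := setup.class_cover v
          rw [hvN v hv, setup.color_on_class l hl v hvl]
          refine mem_union_left _ ?_
          by_cases hlr : l = r
          · subst hlr
            exact mem_union_right _ (Finset.mem_Icc.2 ⟨hcr, hbig⟩)
          · refine mem_union_left _ (mem_image_of_mem c (mem_erase.2 ⟨hlr, mem_erase.2 ⟨?_, hl⟩⟩))
            rintro rfl
            exact hv hvl
      · rw [hvR]
        exact mem_union_left _ (mem_union_right _ (Finset.mem_Icc.2 (hL.mapsTo trivial)))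
    have hA : A.card ≤ k - 1 := by
      refine card_image_le.trans ?_
      rw [card_erase_of_mem (mem_erase.2
        ⟨hir.symm, Finset.mem_Icc.2 ⟨setup.one_le_r, setup.r_le_t⟩⟩), card_erase_of_mem hi,
        Nat.card_Icc]
      omega
    have hBc : B.card = s * S.card := by
      rw [hB, Nat.card_Icc]
      omega
    have h1 := card_le_card hsub
    have h2 := card_union_le (A ∪ B) {C}
    have h3 := card_union_le A B
    rw [card_singleton] at h2
    rw [colorCount]
    omega
  have hmem : colorCount (attachPendants G S s) g ∈
      {n | ∃ g', IsLocalAntimagic (attachPendants G S s) g' ∧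
        colorCount (attachPendants G S s) g' = n} := ⟨g, hg, rfl⟩
  refine le_antisymm ((Nat.sInf_le hmem).trans hup) (le_csInf ⟨_, hmem⟩ ?_)
  rintro _ ⟨g', hg', rfl⟩
  have := hg'.pendantCount_lt_colorCount (by omega)
  omega

end LocalAntimagic
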